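/- Let λ be a proper partition (not a hook, i.e. b(λ) ≥ 2). Then there exists a hook μ with μ ↗ λ if and only if λ = [a+2, 2, 1^b] for some a, b ≥ 0. Moreover, for a, b ≥ 1, the set of partitions covered by [a+2,2,1^b] is exactly P([a+2,2,1^b]) = {[a+1,2,1^b], [a+2,2,1^{b−1}], [a+2,1^{b+1}]}. -/

import Mathlib

/-- A partition: a weakly decreasing sequence of naturals, almost all zero.
`l i` is the length of row `i + 1` (rows are 0-indexed, so `l i = λ_{i+1}`). -/
def IsPart (l : ℕ → ℕ) : Prop :=
  (∀ i, l (i + 1) ≤ l i) ∧ ∃ N, ∀ i, N ≤ i → l i = 0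

/-- The set of cells `(row, column)` (0-indexed) of the Young diagram of `l`. -/
def pcells (l : ℕ → ℕ) : Set (ℕ × ℕ) := {p | p.2 < l p.1}

/-- The size `|λ|` of the partition (number of cells of its Young diagram). -/
noncomputable def psize (l : ℕ → ℕ) : ℕ := Nat.card (pcells l)

/-- The conjugate (transposed) partition `λ'`: `pconj l j = #{i : λ_{i+1} ≥ j+1}`. -/
noncomputable def pconj (l : ℕ → ℕ) : ℕ → ℕ := fun j => Nat.card {i : ℕ | j < l i}

/-- `μ ↗ λ` : `μ_i ≤ λ_i` for all `i` and `|μ| = |λ| - 1`. -/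
def PCovers (m l : ℕ → ℕ) : Prop := (∀ i, m i ≤ l i) ∧ psize m + 1 = psize l

/-- `b(λ)`, the length of the diagonal of `λ` (number of `i ≥ 1` with `λ_i ≥ i`). -/
noncomputable def pdiag (l : ℕ → ℕ) : ℕ := Nat.card {i : ℕ | i < l i}

/-- `δ(λ)`, the number of descents (removable corners) of `λ`. -/
noncomputable def pdelta (l : ℕ → ℕ) : ℕ := Nat.card {r : ℕ | l (r + 1) < l r}

/-- `λ^{(r)}` for the descent at 0-indexed row `r`: decrease that row by one. -/
def premove (l : ℕ → ℕ) (r : ℕ) : ℕ → ℕ := Function.update l r (l r - 1)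

/-- The partition `D(a,b) = [a+2, 2, 1^b]` (0-indexed rows). -/
def dab (a b : ℕ) : ℕ → ℕ := fun i =>
  if i = 0 then a + 2 else if i = 1 then 2 else if i < b + 2 then 1 else 0

/-- The hook partition `[c, 1^r]` (0-indexed rows). -/
def hookp (c r : ℕ) : ℕ → ℕ := fun i => if i = 0 then c else if i < r + 1 then 1 else 0

theorem aux_anti {l : ℕ → ℕ} (hl : IsPart l) : Antitone l := antitone_nat_of_succ_le hl.1

theorem aux_fin {l : ℕ → ℕ} (hl : IsPart l) : (pcells l).Finite := by
  obtain ⟨N, hN⟩ := hl.2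
  refine Set.Finite.subset ((Set.finite_Iio N).prod (Set.finite_Iio (l 0))) ?_
  rintro ⟨i, j⟩ h
  simp only [pcells, Set.mem_ofPred_eq] at h
  refine ⟨?_, ?_⟩
  · by_contra hc
    have := hN i (by simpa using hc)
    omega
  · have := aux_anti hl (Nat.zero_le i)
    simp only [Set.mem_Iio]
    omega

theorem aux_cov {m l : ℕ → ℕ} (hl : IsPart l) :
    PCovers m l ↔ ∃ r, 0 < l r ∧ m = premove l r := by
  have hf := aux_fin hl
  constructor
  · rintro ⟨hle, hs⟩
    have hsub : pcells m ⊆ pcells l := fun p hp => lt_of_lt_of_le hp (hle p.1)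
    have hs' : (pcells m).ncard + 1 = (pcells l).ncard := hs
    have hd := Set.ncard_sdiff_add_ncard_of_subset hsub hf
    have h1 : (pcells l \ pcells m).ncard = 1 := by omega
    obtain ⟨⟨r, c⟩, hp⟩ := Set.ncard_eq_one.1 h1
    have key : ∀ i j, (j < l i ∧ ¬ j < m i) ↔ (i = r ∧ j = c) := by
      intro i j
      have := Set.ext_iff.1 hp (i, j)
      simpa [pcells] using this
    have hrc := (key r c).2 ⟨rfl, rfl⟩
    refine ⟨r, by omega, ?_⟩
    funext i
    have h2 := hle i
    have h3 := key i (m i)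
    have h4 := key i (l i - 1)
    by_cases hi : i = r
    · subst hi
      simp only [premove, Function.update_self]
      simp only [true_and] at h3 h4
      omega
    · simp only [premove, Function.update_of_ne hi]
      simp only [hi, false_and, iff_false] at h3
      omega
  · rintro ⟨r, hr, rfl⟩
    have hle : ∀ i, premove l r i ≤ l i := by
      intro i
      by_cases hi : i = r
      · subst hi; simp [premove]
      · simp [premove, hi]
    refine ⟨hle, ?_⟩
    have hsub : pcells (premove l r) ⊆ pcells l := fun p hp => lt_of_lt_of_le hp (hle p.1)
    have he : pcells l = insert (r, l r - 1) (pcells (premove l r)) := by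
      ext ⟨i, j⟩
      simp only [pcells, Set.mem_ofPred_eq, Set.mem_insert_iff, Prod.mk.injEq]
      by_cases hi : i = r
      · subst hi
        simp only [premove, Function.update_self, true_and]
        omega
      · simp [premove, hi]
    have hn : (r, l r - 1) ∉ pcells (premove l r) := by simp [pcells, premove]
    have := Set.ncard_insert_of_notMem hn (hf.subset hsub)
    rw [← he] at this
    exact this.symm

theorem aux_diag {l : ℕ → ℕ} (hl : IsPart l) : 2 ≤ pdiag l ↔ 2 ≤ l 1 := by
  change 2 ≤ ({i : ℕ | i < l i}).ncard ↔ _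
  have ha := aux_anti hl
  constructor
  · intro h
    by_contra hc
    have hs : {i : ℕ | i < l i} ⊆ {0} := by
      intro i hi
      simp only [Set.mem_ofPred_eq] at hi
      simp only [Set.mem_singleton_iff]
      by_contra h0
      have := ha (show 1 ≤ i by omega)
      omega
    have := Set.ncard_le_ncard hs
    simp at this
    omega
  · intro h
    have hs : ({0, 1} : Set ℕ) ⊆ {i : ℕ | i < l i} := by
      have := ha (show 0 ≤ 1 by omega)
      intro i hi
      simp only [Set.mem_insert_iff, Set.mem_singleton_iff] at hi
      simp only [Set.mem_ofPred_eq]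
      rcases hi with rfl | rfl <;> omega
    have hfin : {i : ℕ | i < l i}.Finite := by
      refine (Set.finite_Iio (l 0)).subset ?_
      intro i hi
      exact lt_of_lt_of_le hi (ha (Nat.zero_le i))
    have := Set.ncard_le_ncard hs hfin
    rwa [Set.ncard_pair (by norm_num)] at this

theorem aux_dab (a b : ℕ) : IsPart (dab a b) := by
  refine ⟨fun i => ?_, b + 2, fun i hi => ?_⟩ <;> simp only [dab] <;> grind

theorem aux_hook (c r : ℕ) (hc : 1 ≤ c) : IsPart (hookp c r) := by
  refine ⟨fun i => ?_, r + 1, fun i hi => ?_⟩ <;> simp only [hookp] <;> grind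

theorem aux_rm1 (a b : ℕ) : hookp (a + 2) (b + 1) = premove (dab a b) 1 := by
  funext i
  simp only [hookp, premove, dab, Function.update_apply]
  grind

theorem aux_rm0 (a b : ℕ) (ha : 1 ≤ a) : dab (a - 1) b = premove (dab a b) 0 := by
  funext i
  simp only [premove, dab, Function.update_apply]
  grind

theorem aux_rmb (a b : ℕ) (hb : 1 ≤ b) : dab a (b - 1) = premove (dab a b) (b + 1) := by
  funext i
  simp only [premove, dab, Function.update_apply]
  grind

/-- Let `λ` be a proper partition (not a hook, i.e. `b(λ) ≥ 2`).  Then some hook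
`μ` satisfies `μ ↗ λ` if and only if `λ = [a+2,2,1^b]` for some `a, b ≥ 0`.
Moreover, for `a, b ≥ 1`, the partitions `μ ↗ [a+2,2,1^b]` are exactly
`[a+1,2,1^b]`, `[a+2,2,1^{b-1}]` and `[a+2,1^{b+1}]`. -/
theorem hook_cover_iff_dab (l : ℕ → ℕ) (hl : IsPart l) (hproper : 2 ≤ pdiag l) :
    ((∃ m : ℕ → ℕ, IsPart m ∧ pdiag m ≤ 1 ∧ PCovers m l) ↔ ∃ a b : ℕ, l = dab a b) ∧
    (∀ a b : ℕ, 1 ≤ a → 1 ≤ b → ∀ m : ℕ → ℕ,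
      (IsPart m ∧ PCovers m (dab a b)) ↔
        (m = dab (a - 1) b ∨ m = dab a (b - 1) ∨ m = hookp (a + 2) (b + 1))) := by
  refine ⟨⟨?_, ?_⟩, ?_⟩
  · rintro ⟨m, hm, hd, hc⟩
    have h1 := (aux_diag hl).1 hproper
    have h2 : ¬ 2 ≤ m 1 := fun h => by
      have := (aux_diag hm).2 h
      omega
    obtain ⟨r, hr, rfl⟩ := (aux_cov hl).1 hc
    have hr1 : r = 1 := by
      by_contra hne
      apply h2
      simpa [premove, Function.update_of_ne (Ne.symm hne)] using h1
    subst hr1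
    have h3 := hm.1 1
    have h0 := hl.1 0
    simp [premove] at h2 h3 h0
    have hex : ∃ b, l (b + 2) = 0 := by
      obtain ⟨N, hN⟩ := hl.2
      exact ⟨N, hN _ (by omega)⟩
    classical
    refine ⟨l 0 - 2, Nat.find hex, ?_⟩
    funext i
    simp only [dab]
    split_ifs with hi0 hi1 hib
    · subst hi0; omega
    · subst hi1; omega
    · have h4 := Nat.find_min hex (m := i - 2) (by omega)
      rw [show i - 2 + 2 = i by omega] at h4
      have := aux_anti hl (show 2 ≤ i by omega)
      omega
    · have h4 := Nat.find_spec hex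
      have := aux_anti hl (show Nat.find hex + 2 ≤ i by omega)
      omega
  · rintro ⟨a, b, rfl⟩
    have hh := aux_hook (a + 2) (b + 1) (by omega)
    refine ⟨hookp (a + 2) (b + 1), hh, ?_, (aux_cov hl).2 ⟨1, by simp [dab], aux_rm1 a b⟩⟩
    by_contra hc
    have := (aux_diag hh).1 (by omega)
    simp [hookp] at this
  · intro a b ha hb m
    rw [aux_cov (aux_dab a b)]
    constructor
    · rintro ⟨hm, r, hr, rfl⟩
      have h := hm.1 r
      have hcase : r = 0 ∨ r = b + 1 ∨ r = 1 := by
        by_contra hc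
        simp only [premove, Function.update_apply, dab] at h hr
        split_ifs at h hr <;> omega
      rcases hcase with rfl | rfl | rfl
      · exact Or.inl (aux_rm0 a b ha).symm
      · exact Or.inr (Or.inl (aux_rmb a b hb).symm)
      · exact Or.inr (Or.inr (aux_rm1 a b).symm)
    · rintro (rfl | rfl | rfl)
      · exact ⟨aux_dab _ _, 0, by simp [dab], aux_rm0 a b ha⟩
      · exact ⟨aux_dab _ _, b + 1, by simp only [dab]; split_ifs <;> omega, aux_rmb a b hb⟩
      · exact ⟨aux_hook _ _ (by omega), 1, by simp [dab], aux_rm1 a b⟩
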